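/- Let 𝒳 be an LFCM space, C and D coarse 𝒳-modules, t : C → D an approximable operator, and u a central unitary of End_{𝒜(𝒳)}(C). Then there exists a central unitary v of End_{𝒜(𝒳)}(D) such that t u = v t. Consequently, the relation ≅_u (equivalence of approximable operators modulo pre- and post-composition with central unitaries) is a congruence on the approximable category 𝒜(𝒳): if t₁ ≅_u t₂ for t₁, t₂ : C → D and s₁ ≅_u s₂ for s₁, s₂ : D → G, then s₁ t₁ ≅_u s₂ t₂. -/

import Mathlib

noncomputable section

open scoped ENNReal

/-! ## Relations -/

/-- Composition of relations: for `R ⊆ Z × Y` and `S ⊆ Y × X`,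
`RelComp R S = {(z,x) | ∃ y, (z,y) ∈ R ∧ (y,x) ∈ S}`. -/
def RelComp {X Y Z : Type} (R : Set (Z × Y)) (S : Set (Y × X)) : Set (Z × X) :=
  {p | ∃ y, (p.1, y) ∈ R ∧ (y, p.2) ∈ S}

/-- Transpose of a relation. -/
def RelTrans {X Y : Type} (R : Set (Y × X)) : Set (X × Y) := {p | (p.2, p.1) ∈ R}

/-! ## Coarse spaces -/

/-- A coarse structure on a set `X`. -/
structure CoarseSpace (X : Type) where
  entourages : Set (Set (X × X))
  diagonal_mem : {p : X × X | p.1 = p.2} ∈ entourages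
  mem_of_subset : ∀ {E F : Set (X × X)}, E ∈ entourages → F ⊆ E → F ∈ entourages
  union_mem : ∀ {E F : Set (X × X)}, E ∈ entourages → F ∈ entourages → E ∪ F ∈ entourages
  transpose_mem : ∀ {E : Set (X × X)}, E ∈ entourages → RelTrans E ∈ entourages
  comp_mem : ∀ {E F : Set (X × X)}, E ∈ entourages → F ∈ entourages → RelComp E F ∈ entourages

namespace CoarseSpace

variable {X Y : Type}

/-- A gauge: a symmetric entourage containing the diagonal. -/
def IsGauge (C : CoarseSpace X) (E : Set (X × X)) : Prop :=
  E ∈ C.entourages ∧ RelTrans E = E ∧ {p : X × X | p.1 = p.2} ⊆ E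

/-- The `E`-neighbourhood `E[A]` of a set `A`. -/
def nbhd (E : Set (X × X)) (A : Set X) : Set X := {x | ∃ a ∈ A, (x, a) ∈ E}

/-- A set is bounded if `A × A` is contained in some entourage. -/
def IsBounded (C : CoarseSpace X) (A : Set X) : Prop := ∃ E ∈ C.entourages, A ×ˢ A ⊆ E

/-- `A ≺ B` : `A` is subordinate to `B`. -/
def Subordinate (C : CoarseSpace X) (A B : Set X) : Prop := ∃ E ∈ C.entourages, A ⊆ nbhd E B

/-- `A ≍ B` : asymptotic equivalence of subsets. -/
def Asymptotic (C : CoarseSpace X) (A B : Set X) : Prop :=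
  C.Subordinate A B ∧ C.Subordinate B A

/-- A coarse map between coarse spaces. -/
def IsCoarseMap (CX : CoarseSpace X) (CY : CoarseSpace Y) (f : X → Y) : Prop :=
  ∀ E ∈ CX.entourages, (fun p : X × X => (f p.1, f p.2)) '' E ∈ CY.entourages

/-- Two maps are close. -/
def Close (CX : CoarseSpace X) (CY : CoarseSpace Y) (f g : X → Y) : Prop :=
  ∀ E ∈ CX.entourages, (fun p : X × X => (f p.1, g p.2)) '' E ∈ CY.entourages

/-- A coarse equivalence (of maps). -/
def IsCoarseEquivMap (CX : CoarseSpace X) (CY : CoarseSpace Y) (f : X → Y) : Prop :=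
  IsCoarseMap CX CY f ∧ ∃ g : Y → X, IsCoarseMap CY CX g ∧
    Close CY CY (f ∘ g) id ∧ Close CX CX (g ∘ f) id

/-- A coarse embedding: a coarse map which is in addition expansive (equivalently, a coarse
equivalence onto its image with the subspace coarse structure). -/
def IsCoarseEmbedding (CX : CoarseSpace X) (CY : CoarseSpace Y) (f : X → Y) : Prop :=
  IsCoarseMap CX CY f ∧
    ∀ F ∈ CY.entourages, {p : X × X | (f p.1, f p.2) ∈ F} ∈ CX.entourages

/-- A coarse structure is countably generated if it is the smallest coarse structure
containing some countable family of subsets of `X × X`. -/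
def IsCountablyGenerated (C : CoarseSpace X) : Prop :=
  ∃ G : Set (Set (X × X)), G.Countable ∧ G ⊆ C.entourages ∧
    ∀ C' : CoarseSpace X, G ⊆ C'.entourages → C.entourages ⊆ C'.entourages

end CoarseSpace

/-- Subordination of relations `R₁, R₂ ⊆ Y × X` with respect to the product coarse structure. -/
def RelSub {X Y : Type} (CX : CoarseSpace X) (CY : CoarseSpace Y)
    (R₁ R₂ : Set (Y × X)) : Prop :=
  ∃ F ∈ CY.entourages, ∃ E ∈ CX.entourages,
    ∀ p ∈ R₁, ∃ q ∈ R₂, (p.1, q.1) ∈ F ∧ (p.2, q.2) ∈ E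

/-- Asymptotic equivalence of relations `R₁, R₂ ⊆ Y × X`. -/
def RelAsymp {X Y : Type} (CX : CoarseSpace X) (CY : CoarseSpace Y)
    (R₁ R₂ : Set (Y × X)) : Prop :=
  RelSub CX CY R₁ R₂ ∧ RelSub CX CY R₂ R₁

/-! ## LFCM spaces -/

/-- A discrete partition of a coarse space endowed with a Boolean algebra `meas` of subsets:
a measurable, locally finite, controlled partition `P` such that a set is measurable iff its
intersection with every block is measurable. -/
structure IsDiscretePartition {X : Type} (C : CoarseSpace X) (meas : Set (Set X))
    (P : Set (Set X)) : Prop where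
  nonempty : ∀ A ∈ P, A.Nonempty
  pairwiseDisjoint : ∀ A ∈ P, ∀ B ∈ P, A ≠ B → Disjoint A B
  covers : ⋃₀ P = Set.univ
  measurable : P ⊆ meas
  locallyFinite : ∀ B : Set X, C.IsBounded B → {A | A ∈ P ∧ (A ∩ B).Nonempty}.Finite
  controlled : ∃ E, C.IsGauge E ∧ ∀ A ∈ P, A ×ˢ A ⊆ E
  meas_iff : ∀ B : Set X, B ∈ meas ↔ ∀ A ∈ P, B ∩ A ∈ meas

/-- A locally finite coarse measurable (LFCM) space: a coarse space together with a Boolean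
algebra of subsets admitting a discrete partition (a chosen one is part of the data). -/
structure LFCMSpace (X : Type) where
  coarse : CoarseSpace X
  meas : Set (Set X)
  empty_mem : ∅ ∈ meas
  compl_mem : ∀ {A : Set X}, A ∈ meas → Aᶜ ∈ meas
  union_mem : ∀ {A B : Set X}, A ∈ meas → B ∈ meas → A ∪ B ∈ meas
  partition : Set (Set X)
  isPartition : IsDiscretePartition coarse meas partition

namespace LFCMSpace

variable {X Y : Type}

/-- The discreteness gauge `E_disc = ⊔_{A ∈ P} A × A` of an LFCM space. -/
def disc (𝒳 : LFCMSpace X) : Set (X × X) := ⋃ A ∈ 𝒳.partition, A ×ˢ A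

/-- A discreteness gauge: a gauge bounding the blocks of some discrete partition. -/
def IsDiscretenessGauge (𝒳 : LFCMSpace X) (E : Set (X × X)) : Prop :=
  𝒳.coarse.IsGauge E ∧
    ∃ P, IsDiscretePartition 𝒳.coarse 𝒳.meas P ∧ ∀ A ∈ P, A ×ˢ A ⊆ E

end LFCMSpace

/-- A coarse measurable map between LFCM spaces. -/
def IsCoarseMeasurableMap {X Y : Type} (𝒳 : LFCMSpace X) (𝒴 : LFCMSpace Y) (f : X → Y) : Prop :=
  CoarseSpace.IsCoarseMap 𝒳.coarse 𝒴.coarse f ∧ ∀ B ∈ 𝒴.meas, f ⁻¹' B ∈ 𝒳.meas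

/-! ## Coarse geometric modules -/

/-- A coarse geometric module over an LFCM space `𝒳`: a representation of the Boolean algebra
of measurable sets by orthogonal projections on a complex Hilbert space, nondegenerate on
bounded sets. -/
structure CoarseModule {X : Type} (𝒳 : LFCMSpace X) (H : Type) [NormedAddCommGroup H]
    [InnerProductSpace ℂ H] [CompleteSpace H] where
  proj : Set X → (H →L[ℂ] H)
  proj_empty : proj ∅ = 0
  proj_selfAdjoint : ∀ A ∈ 𝒳.meas, IsSelfAdjoint (proj A)
  proj_inter : ∀ {A B : Set X}, A ∈ 𝒳.meas → B ∈ 𝒳.meas → proj (A ∩ B) = proj A ∘L proj B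
  proj_union : ∀ {A B : Set X}, A ∈ 𝒳.meas → B ∈ 𝒳.meas → Disjoint A B →
      proj (A ∪ B) = proj A + proj B
  nondeg : Dense (↑(Submodule.span ℂ
      (⋃ A ∈ {A | A ∈ 𝒳.meas ∧ 𝒳.coarse.IsBounded A}, Set.range (proj A))) : Set H)

variable {X Y Z : Type}
variable {H₀ H₁ H₂ H₃ : Type}

/-- The support of a bounded operator between Hilbert spaces carrying representations
`pX`, `pY` of the measurable sets of LFCM spaces `𝒳` (source) and `𝒴` (target). -/
def opSupp [NormedAddCommGroup H₁] [InnerProductSpace ℂ H₁]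
    [NormedAddCommGroup H₂] [InnerProductSpace ℂ H₂]
    (𝒳 : LFCMSpace X) (𝒴 : LFCMSpace Y)
    (pX : Set X → (H₁ →L[ℂ] H₁)) (pY : Set Y → (H₂ →L[ℂ] H₂))
    (t : H₁ →L[ℂ] H₂) : Set (Y × X) :=
  ⋃₀ {S | ∃ B A, S = B ×ˢ A ∧ B ∈ 𝒴.meas ∧ B ×ˢ B ⊆ 𝒴.disc ∧
      A ∈ 𝒳.meas ∧ A ×ˢ A ⊆ 𝒳.disc ∧ pY B ∘L t ∘L pX A ≠ 0}

/-- Controlled propagation of an operator between modules over the same LFCM space. -/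
def HasControlledPropagation [NormedAddCommGroup H₁] [InnerProductSpace ℂ H₁]
    [NormedAddCommGroup H₂] [InnerProductSpace ℂ H₂]
    (𝒳 : LFCMSpace X) (pX : Set X → (H₁ →L[ℂ] H₁)) (pY : Set X → (H₂ →L[ℂ] H₂))
    (t : H₁ →L[ℂ] H₂) : Prop :=
  opSupp 𝒳 𝒳 pX pY t ∈ 𝒳.coarse.entourages

/-- Approximable operators: norm-limits of controlled propagation operators. -/
def Approximable [NormedAddCommGroup H₁] [InnerProductSpace ℂ H₁]
    [NormedAddCommGroup H₂] [InnerProductSpace ℂ H₂]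
    (𝒳 : LFCMSpace X) (pX : Set X → (H₁ →L[ℂ] H₁)) (pY : Set X → (H₂ →L[ℂ] H₂))
    (t : H₁ →L[ℂ] H₂) : Prop :=
  ∀ ε : ℝ, 0 < ε → ∃ s : H₁ →L[ℂ] H₂, HasControlledPropagation 𝒳 pX pY s ∧ ‖t - s‖ ≤ ε

/-- The rank (Hilbert dimension of the range) of an operator. -/
def projRank {H : Type} [NormedAddCommGroup H] [InnerProductSpace ℂ H]
    (p : H →L[ℂ] H) : Cardinal :=
  LinearMap.rank (p : H →ₗ[ℂ] H)

/-- The `κ`-domain of a coarse module, computed with respect to an arbitrary gauge `E`. -/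
def domKappaAt {X : Type} {H : Type} [NormedAddCommGroup H] [InnerProductSpace ℂ H]
    [CompleteSpace H] (𝒳 : LFCMSpace X) (M : CoarseModule 𝒳 H) (E : Set (X × X))
    (κ : Cardinal) : Set X :=
  ⋃₀ {A | A ∈ 𝒳.meas ∧ A ×ˢ A ⊆ E ∧ κ ≤ projRank (M.proj A)}

/-- The `κ`-domain of a coarse module (with respect to the discreteness gauge). -/
def domKappa {X : Type} {H : Type} [NormedAddCommGroup H] [InnerProductSpace ℂ H]
    [CompleteSpace H] (𝒳 : LFCMSpace X) (M : CoarseModule 𝒳 H) (κ : Cardinal) : Set X :=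
  domKappaAt 𝒳 M 𝒳.disc κ

/-- A coarse module is faithful if its faithfulness domain is asymptotic to the whole space. -/
def IsFaithfulMod {X : Type} {H : Type} [NormedAddCommGroup H] [InnerProductSpace ℂ H]
    [CompleteSpace H] (𝒳 : LFCMSpace X) (M : CoarseModule 𝒳 H) : Prop :=
  𝒳.coarse.Asymptotic (domKappa 𝒳 M 1) Set.univ

/-- A coarse module is ample if its ampleness domain is asymptotic to the whole space. -/
def IsAmpleMod {X : Type} {H : Type} [NormedAddCommGroup H] [InnerProductSpace ℂ H]
    [CompleteSpace H] (𝒳 : LFCMSpace X) (M : CoarseModule 𝒳 H) : Prop :=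
  𝒳.coarse.Asymptotic (domKappa 𝒳 M Cardinal.aleph0) Set.univ

/-- The approximate relation `f^T_{δ,F,E}` of a bounded operator. -/
def approxRel [NormedAddCommGroup H₁] [InnerProductSpace ℂ H₁]
    [NormedAddCommGroup H₂] [InnerProductSpace ℂ H₂]
    (𝒳 : LFCMSpace X) (𝒴 : LFCMSpace Y)
    (pX : Set X → (H₁ →L[ℂ] H₁)) (pY : Set Y → (H₂ →L[ℂ] H₂))
    (T : H₁ →L[ℂ] H₂) (δ : ℝ) (F : Set (Y × Y)) (E : Set (X × X)) : Set (Y × X) :=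
  ⋃₀ {S | ∃ B A, S = B ×ˢ A ∧ B ∈ 𝒴.meas ∧ B ×ˢ B ⊆ F ∧
      A ∈ 𝒳.meas ∧ A ×ˢ A ⊆ E ∧ δ < ‖pY B ∘L T ∘L pX A‖}

/-- A unitary operator between Hilbert spaces. -/
def IsUnitaryOp [NormedAddCommGroup H₁] [InnerProductSpace ℂ H₁] [CompleteSpace H₁]
    [NormedAddCommGroup H₂] [InnerProductSpace ℂ H₂] [CompleteSpace H₂]
    (U : H₁ →L[ℂ] H₂) : Prop :=
  ContinuousLinearMap.adjoint U ∘L U = ContinuousLinearMap.id ℂ H₁ ∧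
    U ∘L ContinuousLinearMap.adjoint U = ContinuousLinearMap.id ℂ H₂

/-- A central unitary of the C*-algebra of approximable operators on a coarse module. -/
def IsCentralUnitary {X : Type} {H : Type} [NormedAddCommGroup H] [InnerProductSpace ℂ H]
    [CompleteSpace H] (𝒳 : LFCMSpace X) (M : CoarseModule 𝒳 H) (u : H →L[ℂ] H) : Prop :=
  Approximable 𝒳 M.proj M.proj u ∧ IsUnitaryOp u ∧
    ∀ t : H →L[ℂ] H, Approximable 𝒳 M.proj M.proj t → u ∘L t = t ∘L u

/-- Equivalence of operators modulo central unitaries. -/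
def CongruentModCentral {X : Type} [NormedAddCommGroup H₁] [InnerProductSpace ℂ H₁]
    [CompleteSpace H₁] [NormedAddCommGroup H₂] [InnerProductSpace ℂ H₂] [CompleteSpace H₂]
    (𝒳 : LFCMSpace X) (C : CoarseModule 𝒳 H₁) (D : CoarseModule 𝒳 H₂)
    (t s : H₁ →L[ℂ] H₂) : Prop :=
  ∃ u v, IsCentralUnitary 𝒳 C u ∧ IsCentralUnitary 𝒳 D v ∧ t = v ∘L s ∘L u

/-! ## Direct sums of modules -/

/-- The direct sum `T ⊕ S` of two operators, on the `ℓ²`-product of Hilbert spaces. -/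
def prodOp [NormedAddCommGroup H₀] [InnerProductSpace ℂ H₀]
    [NormedAddCommGroup H₁] [InnerProductSpace ℂ H₁]
    [NormedAddCommGroup H₂] [InnerProductSpace ℂ H₂]
    [NormedAddCommGroup H₃] [InnerProductSpace ℂ H₃]
    (T : H₀ →L[ℂ] H₂) (S : H₁ →L[ℂ] H₃) :
    WithLp 2 (H₀ × H₁) →L[ℂ] WithLp 2 (H₂ × H₃) :=
  (WithLp.prodContinuousLinearEquiv 2 ℂ H₂ H₃).symm.toContinuousLinearMap ∘L
    (T.prodMap S) ∘L (WithLp.prodContinuousLinearEquiv 2 ℂ H₀ H₁).toContinuousLinearMap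

/-- The canonical inclusion `H₀ → H₀ ⊕ H₁`. -/
def inlOp (H₀ H₁ : Type) [NormedAddCommGroup H₀] [InnerProductSpace ℂ H₀]
    [NormedAddCommGroup H₁] [InnerProductSpace ℂ H₁] :
    H₀ →L[ℂ] WithLp 2 (H₀ × H₁) :=
  (WithLp.prodContinuousLinearEquiv 2 ℂ H₀ H₁).symm.toContinuousLinearMap ∘L
    ContinuousLinearMap.inl ℂ H₀ H₁

/-- The canonical inclusion `H₁ → H₀ ⊕ H₁`. -/
def inrOp (H₀ H₁ : Type) [NormedAddCommGroup H₀] [InnerProductSpace ℂ H₀]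
    [NormedAddCommGroup H₁] [InnerProductSpace ℂ H₁] :
    H₁ →L[ℂ] WithLp 2 (H₀ × H₁) :=
  (WithLp.prodContinuousLinearEquiv 2 ℂ H₀ H₁).symm.toContinuousLinearMap ∘L
    ContinuousLinearMap.inr ℂ H₀ H₁

/-- The canonical projection `H₀ ⊕ H₁ → H₀`. -/
def fstOp (H₀ H₁ : Type) [NormedAddCommGroup H₀] [InnerProductSpace ℂ H₀]
    [NormedAddCommGroup H₁] [InnerProductSpace ℂ H₁] :
    WithLp 2 (H₀ × H₁) →L[ℂ] H₀ :=
  ContinuousLinearMap.fst ℂ H₀ H₁ ∘L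
    (WithLp.prodContinuousLinearEquiv 2 ℂ H₀ H₁).toContinuousLinearMap

/-- The canonical projection `H₀ ⊕ H₁ → H₁`. -/
def sndOp (H₀ H₁ : Type) [NormedAddCommGroup H₀] [InnerProductSpace ℂ H₀]
    [NormedAddCommGroup H₁] [InnerProductSpace ℂ H₁] :
    WithLp 2 (H₀ × H₁) →L[ℂ] H₁ :=
  ContinuousLinearMap.snd ℂ H₀ H₁ ∘L
    (WithLp.prodContinuousLinearEquiv 2 ℂ H₀ H₁).toContinuousLinearMap

/-- `M` is the direct sum of the coarse modules `C₀` and `C₁`. -/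
def IsDirectSum {X : Type} [NormedAddCommGroup H₀] [InnerProductSpace ℂ H₀] [CompleteSpace H₀]
    [NormedAddCommGroup H₁] [InnerProductSpace ℂ H₁] [CompleteSpace H₁]
    (𝒳 : LFCMSpace X) (C₀ : CoarseModule 𝒳 H₀) (C₁ : CoarseModule 𝒳 H₁)
    (M : CoarseModule 𝒳 (WithLp 2 (H₀ × H₁))) : Prop :=
  ∀ A : Set X, M.proj A = prodOp (C₀.proj A) (C₁.proj A)

/-! ## Bundled modules and *-functors -/

/-- A coarse module over `𝒳` bundled together with its Hilbert space; the objects of the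
approximable category `𝒜(𝒳)`. -/
structure BundledModule {X : Type} (𝒳 : LFCMSpace X) where
  H : Type
  [instNorm : NormedAddCommGroup H]
  [instInner : InnerProductSpace ℂ H]
  [instComplete : CompleteSpace H]
  mod : CoarseModule 𝒳 H

attribute [instance] BundledModule.instNorm BundledModule.instInner BundledModule.instComplete

/-- A *-functor `𝒜(𝒳) → 𝒜(𝒴)` between approximable categories: a map on objects together
with a ℂ-linear, multiplicative, adjoint-preserving map on approximable operators. -/
structure StarFunctor {X Y : Type} (𝒳 : LFCMSpace X) (𝒴 : LFCMSpace Y) where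
  obj : BundledModule 𝒳 → BundledModule 𝒴
  map : ∀ {C D : BundledModule 𝒳} (t : C.H →L[ℂ] D.H),
      Approximable 𝒳 C.mod.proj D.mod.proj t → ((obj C).H →L[ℂ] (obj D).H)
  map_approximable : ∀ {C D : BundledModule 𝒳} (t : C.H →L[ℂ] D.H)
      (ht : Approximable 𝒳 C.mod.proj D.mod.proj t),
      Approximable 𝒴 (obj C).mod.proj (obj D).mod.proj (map t ht)
  map_id : ∀ (C : BundledModule 𝒳)
      (h : Approximable 𝒳 C.mod.proj C.mod.proj (ContinuousLinearMap.id ℂ C.H)),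
      map (ContinuousLinearMap.id ℂ C.H) h = ContinuousLinearMap.id ℂ (obj C).H
  map_comp : ∀ {C D G : BundledModule 𝒳} (t : C.H →L[ℂ] D.H) (s : D.H →L[ℂ] G.H)
      (ht : Approximable 𝒳 C.mod.proj D.mod.proj t)
      (hs : Approximable 𝒳 D.mod.proj G.mod.proj s)
      (hst : Approximable 𝒳 C.mod.proj G.mod.proj (s ∘L t)),
      map (s ∘L t) hst = map s hs ∘L map t ht
  map_add : ∀ {C D : BundledModule 𝒳} (t s : C.H →L[ℂ] D.H)
      (ht : Approximable 𝒳 C.mod.proj D.mod.proj t)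
      (hs : Approximable 𝒳 C.mod.proj D.mod.proj s)
      (hts : Approximable 𝒳 C.mod.proj D.mod.proj (t + s)),
      map (t + s) hts = map t ht + map s hs
  map_smul : ∀ {C D : BundledModule 𝒳} (c : ℂ) (t : C.H →L[ℂ] D.H)
      (ht : Approximable 𝒳 C.mod.proj D.mod.proj t)
      (hct : Approximable 𝒳 C.mod.proj D.mod.proj (c • t)),
      map (c • t) hct = c • map t ht
  map_star : ∀ {C D : BundledModule 𝒳} (t : C.H →L[ℂ] D.H)
      (ht : Approximable 𝒳 C.mod.proj D.mod.proj t)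
      (hstar : Approximable 𝒳 D.mod.proj C.mod.proj (ContinuousLinearMap.adjoint t)),
      map (ContinuousLinearMap.adjoint t) hstar = ContinuousLinearMap.adjoint (map t ht)

namespace StarFunctor

variable {𝒳 : LFCMSpace X} {𝒴 : LFCMSpace Y}

/-- A full functor. -/
def Full (F : StarFunctor 𝒳 𝒴) : Prop :=
  ∀ (C D : BundledModule 𝒳) (s : (F.obj C).H →L[ℂ] (F.obj D).H),
    Approximable 𝒴 (F.obj C).mod.proj (F.obj D).mod.proj s →
    ∃ (t : C.H →L[ℂ] D.H) (ht : Approximable 𝒳 C.mod.proj D.mod.proj t), F.map t ht = s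

/-- A faithful functor. -/
def Faithful (F : StarFunctor 𝒳 𝒴) : Prop :=
  ∀ (C D : BundledModule 𝒳) (t t' : C.H →L[ℂ] D.H)
    (ht : Approximable 𝒳 C.mod.proj D.mod.proj t)
    (ht' : Approximable 𝒳 C.mod.proj D.mod.proj t'),
    F.map t ht = F.map t' ht' → t = t'

/-- An essentially surjective functor (up to isomorphism in the approximable category). -/
def EssSurj (F : StarFunctor 𝒳 𝒴) : Prop :=
  ∀ D' : BundledModule 𝒴, ∃ C : BundledModule 𝒳,
    ∃ u : (F.obj C).H →L[ℂ] D'.H, Approximable 𝒴 (F.obj C).mod.proj D'.mod.proj u ∧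
    ∃ v : D'.H →L[ℂ] (F.obj C).H, Approximable 𝒴 D'.mod.proj (F.obj C).mod.proj v ∧
      v ∘L u = ContinuousLinearMap.id ℂ (F.obj C).H ∧
      u ∘L v = ContinuousLinearMap.id ℂ D'.H

/-- A unitary `U` implements the *-isomorphism induced by `F` on the endomorphism algebra of
a module `C`. -/
def Implements (F : StarFunctor 𝒳 𝒴) (C : BundledModule 𝒳)
    (U : C.H →L[ℂ] (F.obj C).H) : Prop :=
  IsUnitaryOp U ∧ ∀ (t : C.H →L[ℂ] C.H) (ht : Approximable 𝒳 C.mod.proj C.mod.proj t),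
    F.map t ht = U ∘L t ∘L ContinuousLinearMap.adjoint U

end StarFunctor

/-- The graph of a map, as a relation `⊆ Y × X`. -/
def mapGraph {X Y : Type} (f : X → Y) : Set (Y × X) := {p | p.1 = f p.2}

/-- A relation `R ⊆ Y × X` is a coarse equivalence from `DX ⊆ X` to `DY ⊆ Y` (each with the
subspace coarse structure): controlled in both directions, densely defined and coarsely
surjective relative to `DX` and `DY`. -/
def IsRelCoarseEquivOn {X Y : Type} (CX : CoarseSpace X) (CY : CoarseSpace Y)
    (DX : Set X) (DY : Set Y) (R : Set (Y × X)) : Prop :=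
  (∀ E ∈ CX.entourages, RelComp R (RelComp E (RelTrans R)) ∈ CY.entourages) ∧
  (∀ F ∈ CY.entourages, RelComp (RelTrans R) (RelComp F R) ∈ CX.entourages) ∧
  CX.Asymptotic (Prod.snd '' R) DX ∧ CY.Asymptotic (Prod.fst '' R) DY

/-- `S ⊆ X × Y` is a coarse inverse of the relation `R ⊆ Y × X` between `DX` and `DY`:
both compositions are asymptotic to the respective (restricted) diagonals. -/
def IsRelCoarseInverseOn {X Y : Type} (CX : CoarseSpace X) (CY : CoarseSpace Y)
    (DX : Set X) (DY : Set Y) (R : Set (Y × X)) (S : Set (X × Y)) : Prop :=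
  RelAsymp CX CX (RelComp S R) {p : X × X | p.1 = p.2 ∧ p.1 ∈ DX} ∧
  RelAsymp CY CY (RelComp R S) {p : Y × Y | p.1 = p.2 ∧ p.1 ∈ DY}

/-- The statement that a coarse map `f` represents the coarse embedding induced by a full and
faithful *-functor `F` via approximate relations of implementing unitaries. -/
def RepresentsInducedEmbedding {X Y : Type} {𝒳 : LFCMSpace X} {𝒴 : LFCMSpace Y}
    (F : StarFunctor 𝒳 𝒴) (f : X → Y) : Prop :=
  ∀ (C : BundledModule 𝒳), IsFaithfulMod 𝒳 C.mod →
  ∀ (U : C.H →L[ℂ] (F.obj C).H), F.Implements C U →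
  ∀ δ : ℝ, 0 < δ → δ < 1 →
  ∃ F₀ ∈ 𝒴.coarse.entourages, ∃ E₀ ∈ 𝒳.coarse.entourages,
    ∀ F' ∈ 𝒴.coarse.entourages, F₀ ⊆ F' → ∀ E ∈ 𝒳.coarse.entourages, E₀ ⊆ E →
      RelAsymp 𝒳.coarse 𝒴.coarse
        (approxRel 𝒳 𝒴 C.mod.proj (F.obj C).mod.proj U δ F' E) (mapGraph f)

/-- Bundle a coarse module into an object of the approximable category. -/
abbrev BundledModule.ofModule {X : Type} {𝒳 : LFCMSpace X} {H : Type} [NormedAddCommGroup H]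
    [InnerProductSpace ℂ H] [CompleteSpace H] (M : CoarseModule 𝒳 H) : BundledModule 𝒳 :=
  ⟨H, M⟩

theorem LFCMSpace.disc_mem {X : Type} (𝒳 : LFCMSpace X) :
    𝒳.disc ∈ 𝒳.coarse.entourages := by
  obtain ⟨E, hE, hEP⟩ := 𝒳.isPartition.controlled
  refine 𝒳.coarse.mem_of_subset hE.1 ?_
  intro p hp
  simp only [LFCMSpace.disc, Set.mem_iUnion] at hp
  obtain ⟨A, hA, hpA⟩ := hp
  exact hEP A hA hpA

theorem prodOp_comp_inlOp {H₀ H₁ H₂ H₃ : Type}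
    [NormedAddCommGroup H₀] [InnerProductSpace ℂ H₀]
    [NormedAddCommGroup H₁] [InnerProductSpace ℂ H₁]
    [NormedAddCommGroup H₂] [InnerProductSpace ℂ H₂]
    [NormedAddCommGroup H₃] [InnerProductSpace ℂ H₃]
    (T : H₀ →L[ℂ] H₂) (S : H₁ →L[ℂ] H₃) :
    prodOp T S ∘L inlOp H₀ H₁ = inlOp H₂ H₃ ∘L T := by
  ext x
  simp [prodOp, inlOp]

theorem prodOp_comp_inrOp {H₀ H₁ H₂ H₃ : Type}
    [NormedAddCommGroup H₀] [InnerProductSpace ℂ H₀]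
    [NormedAddCommGroup H₁] [InnerProductSpace ℂ H₁]
    [NormedAddCommGroup H₂] [InnerProductSpace ℂ H₂]
    [NormedAddCommGroup H₃] [InnerProductSpace ℂ H₃]
    (T : H₀ →L[ℂ] H₂) (S : H₁ →L[ℂ] H₃) :
    prodOp T S ∘L inrOp H₀ H₁ = inrOp H₂ H₃ ∘L S := by
  ext x
  simp [prodOp, inrOp]

/-- The canonical inclusion into a direct sum of coarse modules is approximable
(indeed it has controlled propagation). -/
theorem IsDirectSum.approximable_inl {X : Type} {H₀ H₁ : Type}
    [NormedAddCommGroup H₀] [InnerProductSpace ℂ H₀] [CompleteSpace H₀]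
    [NormedAddCommGroup H₁] [InnerProductSpace ℂ H₁] [CompleteSpace H₁]
    {𝒳 : LFCMSpace X} {C₀ : CoarseModule 𝒳 H₀} {C₁ : CoarseModule 𝒳 H₁}
    {M : CoarseModule 𝒳 (WithLp 2 (H₀ × H₁))} (hM : IsDirectSum 𝒳 C₀ C₁ M) :
    Approximable 𝒳 C₀.proj M.proj (inlOp H₀ H₁) := by
  intro ε hε
  refine ⟨inlOp H₀ H₁, ?_, by simp [hε.le]⟩
  refine 𝒳.coarse.mem_of_subset (𝒳.coarse.comp_mem 𝒳.disc_mem 𝒳.disc_mem) ?_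
  rintro ⟨y, x⟩ hyx
  obtain ⟨s, ⟨B, A, rfl, hBmeas, hBb, hAmeas, hAb, hne⟩, hmem⟩ := hyx
  have key : M.proj B ∘L inlOp H₀ H₁ ∘L C₀.proj A
      = inlOp H₀ H₁ ∘L C₀.proj (B ∩ A) := by
    rw [C₀.proj_inter hBmeas hAmeas, hM B, ← ContinuousLinearMap.comp_assoc,
      prodOp_comp_inlOp, ContinuousLinearMap.comp_assoc]
  have hBA : (B ∩ A).Nonempty := by
    by_contra h
    rw [Set.not_nonempty_iff_eq_empty] at h
    apply hne
    rw [key, h, C₀.proj_empty]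
    ext z
    simp
  obtain ⟨z, hzB, hzA⟩ := hBA
  obtain ⟨hyB, hxA⟩ := hmem
  exact ⟨z, hBb ⟨hyB, hzB⟩, hAb ⟨hzA, hxA⟩⟩

theorem IsDirectSum.approximable_inr {X : Type} {H₀ H₁ : Type}
    [NormedAddCommGroup H₀] [InnerProductSpace ℂ H₀] [CompleteSpace H₀]
    [NormedAddCommGroup H₁] [InnerProductSpace ℂ H₁] [CompleteSpace H₁]
    {𝒳 : LFCMSpace X} {C₀ : CoarseModule 𝒳 H₀} {C₁ : CoarseModule 𝒳 H₁}
    {M : CoarseModule 𝒳 (WithLp 2 (H₀ × H₁))} (hM : IsDirectSum 𝒳 C₀ C₁ M) :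
    Approximable 𝒳 C₁.proj M.proj (inrOp H₀ H₁) := by
  intro ε hε
  refine ⟨inrOp H₀ H₁, ?_, by simp [hε.le]⟩
  refine 𝒳.coarse.mem_of_subset (𝒳.coarse.comp_mem 𝒳.disc_mem 𝒳.disc_mem) ?_
  rintro ⟨y, x⟩ hyx
  obtain ⟨s, ⟨B, A, rfl, hBmeas, hBb, hAmeas, hAb, hne⟩, hmem⟩ := hyx
  have key : M.proj B ∘L inrOp H₀ H₁ ∘L C₁.proj A
      = inrOp H₀ H₁ ∘L C₁.proj (B ∩ A) := by
    rw [C₁.proj_inter hBmeas hAmeas, hM B, ← ContinuousLinearMap.comp_assoc,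
      prodOp_comp_inrOp, ContinuousLinearMap.comp_assoc]
  have hBA : (B ∩ A).Nonempty := by
    by_contra h
    rw [Set.not_nonempty_iff_eq_empty] at h
    apply hne
    rw [key, h, C₁.proj_empty]
    ext z
    simp
  obtain ⟨z, hzB, hzA⟩ := hBA
  obtain ⟨hyB, hxA⟩ := hmem
  exact ⟨z, hBb ⟨hyB, hzB⟩, hAb ⟨hzA, hxA⟩⟩

/-! ## Coarse components and componentwise scalar operators -/

namespace CoarseSpace

/-- Two points lie in the same coarse component if they are related by some entourage. -/
def SameComponent (C : CoarseSpace X) (x y : X) : Prop := {(x, y)} ∈ C.entourages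

theorem SameComponent.of_mem {C : CoarseSpace X} {E : Set (X × X)} (hE : E ∈ C.entourages)
    {x y : X} (h : (x, y) ∈ E) : C.SameComponent x y :=
  C.mem_of_subset hE (Set.singleton_subset_iff.2 h)

theorem SameComponent.refl (C : CoarseSpace X) (x : X) : C.SameComponent x x :=
  .of_mem C.diagonal_mem rfl

theorem SameComponent.symm {C : CoarseSpace X} {x y : X} (h : C.SameComponent x y) :
    C.SameComponent y x :=
  .of_mem (C.transpose_mem h) rfl

theorem SameComponent.trans {C : CoarseSpace X} {x y z : X} (h : C.SameComponent x y)
    (h' : C.SameComponent y z) : C.SameComponent x z :=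
  .of_mem (C.comp_mem h h') ⟨y, rfl, rfl⟩

/-- The coarse components of a coarse space, as the classes of an equivalence relation. -/
def componentSetoid (C : CoarseSpace X) : Setoid X where
  r := C.SameComponent
  iseqv := ⟨SameComponent.refl C, SameComponent.symm, SameComponent.trans⟩

/-- A function which is constant on coarse components. -/
def ConstOnComponents (C : CoarseSpace X) (c : X → ℂ) : Prop :=
  ∀ x y, C.SameComponent x y → c x = c y

end CoarseSpace

namespace LFCMSpace

variable {𝒳 : LFCMSpace X}

theorem inter_mem {A B : Set X} (hA : A ∈ 𝒳.meas) (hB : B ∈ 𝒳.meas) : A ∩ B ∈ 𝒳.meas := by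
  have h := 𝒳.compl_mem (𝒳.union_mem (𝒳.compl_mem hA) (𝒳.compl_mem hB))
  rwa [Set.compl_union, compl_compl, compl_compl] at h

theorem partition_meas {A : Set X} (hA : A ∈ 𝒳.partition) : A ∈ 𝒳.meas :=
  𝒳.isPartition.measurable hA

theorem prod_subset_disc {A : Set X} (hA : A ∈ 𝒳.partition) : A ×ˢ A ⊆ 𝒳.disc :=
  Set.subset_biUnion_of_mem (u := fun A : Set X => A ×ˢ A) hA

theorem eq_of_mem_partition {A B : Set X} (hA : A ∈ 𝒳.partition) (hB : B ∈ 𝒳.partition)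
    {x : X} (hxA : x ∈ A) (hxB : x ∈ B) : A = B := by
  by_contra h
  exact Set.disjoint_left.1 (𝒳.isPartition.pairwiseDisjoint A hA B hB h) hxA hxB

theorem sameComponent_of_mem_partition {A : Set X} (hA : A ∈ 𝒳.partition) {x y : X}
    (hx : x ∈ A) (hy : y ∈ A) : 𝒳.coarse.SameComponent x y :=
  .of_mem 𝒳.disc_mem (prod_subset_disc hA ⟨hx, hy⟩)

theorem exists_partition_superset {A : Set X} (hA : A ×ˢ A ⊆ 𝒳.disc) {x : X} (hx : x ∈ A) :
    ∃ B ∈ 𝒳.partition, A ⊆ B := by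
  have hxx := hA (Set.mk_mem_prod hx hx)
  simp only [disc, Set.mem_iUnion] at hxx
  obtain ⟨B, hB, hxB, -⟩ := hxx
  refine ⟨B, hB, fun y hy => ?_⟩
  have hxy := hA (Set.mk_mem_prod hx hy)
  simp only [disc, Set.mem_iUnion] at hxy
  obtain ⟨B', hB', hxB', hyB'⟩ := hxy
  rwa [eq_of_mem_partition hB hB' hxB hxB']

end LFCMSpace

namespace CoarseModule

variable {𝒳 : LFCMSpace X}
variable [NormedAddCommGroup H₁] [InnerProductSpace ℂ H₁] [CompleteSpace H₁]

theorem proj_proj (C : CoarseModule 𝒳 H₁) {A : Set X} (hA : A ∈ 𝒳.meas) (w : H₁) :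
    C.proj A (C.proj A w) = C.proj A w := by
  have h := C.proj_inter hA hA
  rw [Set.inter_self] at h
  exact (DFunLike.congr_fun h w).symm

theorem proj_proj_of_ne (C : CoarseModule 𝒳 H₁) {A B : Set X} (hA : A ∈ 𝒳.partition)
    (hB : B ∈ 𝒳.partition) (hAB : A ≠ B) (w : H₁) : C.proj A (C.proj B w) = 0 := by
  have h := C.proj_inter (LFCMSpace.partition_meas hA) (LFCMSpace.partition_meas hB)
  rw [(𝒳.isPartition.pairwiseDisjoint A hA B hB hAB).inter_eq, C.proj_empty] at h
  exact (DFunLike.congr_fun h w).symm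

theorem inner_proj (C : CoarseModule 𝒳 H₁) {A : Set X} (hA : A ∈ 𝒳.meas) (v w : H₁) :
    inner ℂ (C.proj A v) w = inner ℂ v (C.proj A w) := by
  rw [← ContinuousLinearMap.adjoint_inner_right, (C.proj_selfAdjoint A hA).adjoint_eq]

/-- A closed subspace containing the ranges of the projections onto all blocks of the discrete
partition is the whole space. -/
theorem eq_top_of_proj_mem (C : CoarseModule 𝒳 H₁) (K : Submodule ℂ H₁)
    (hK : IsClosed (K : Set H₁)) (h : ∀ A ∈ 𝒳.partition, ∀ w, C.proj A w ∈ K) : K = ⊤ := by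
  have key : ∀ F : Set (Set X), F.Finite → F ⊆ 𝒳.partition → ∀ B ∈ 𝒳.meas, B ⊆ ⋃₀ F →
      ∀ w, C.proj B w ∈ K := by
    intro F hF
    induction F, hF using Set.Finite.induction_on with
    | empty =>
      intro _ B _ hBF w
      rw [Set.sUnion_empty, Set.subset_empty_iff] at hBF
      simp [hBF, C.proj_empty]
    | @insert A F _ _ ih =>
      intro hFP B hB hBF w
      have hAP := hFP (Set.mem_insert A F)
      have hA := LFCMSpace.partition_meas hAP
      have hdiff : B \ A ∈ 𝒳.meas := LFCMSpace.inter_mem hB (𝒳.compl_mem hA)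
      have hsplit : C.proj B = C.proj (A ∩ B) + C.proj (B \ A) := by
        rw [← C.proj_union (LFCMSpace.inter_mem hA hB) hdiff
          (Set.disjoint_left.2 fun x hx hx' => hx'.2 hx.1), Set.inter_comm, Set.inter_union_sdiff]
      rw [hsplit, C.proj_inter hA hB]
      refine K.add_mem (h A hAP _) (ih (fun _ hS => hFP (Set.mem_insert_of_mem _ hS)) _ hdiff ?_ w)
      rintro x ⟨hxB, hxA⟩
      obtain ⟨S, hS, hxS⟩ := hBF hxB
      rcases Set.mem_insert_iff.1 hS with rfl | hS
      · exact absurd hxS hxA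
      · exact ⟨S, hS, hxS⟩
  have hspan : Submodule.span ℂ
      (⋃ A ∈ {A | A ∈ 𝒳.meas ∧ 𝒳.coarse.IsBounded A}, Set.range (C.proj A)) ≤ K := by
    rw [Submodule.span_le]
    intro w hw
    simp only [Set.mem_iUnion] at hw
    obtain ⟨B, ⟨hB, hBb⟩, w, rfl⟩ := hw
    refine key _ (𝒳.isPartition.locallyFinite B hBb) (fun _ hS => hS.1) B hB (fun x hx => ?_) w
    obtain ⟨A, hA, hxA⟩ : x ∈ ⋃₀ 𝒳.partition := 𝒳.isPartition.covers ▸ Set.mem_univ x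
    exact ⟨A, ⟨hA, x, hxA, hx⟩, hxA⟩
  rw [← SetLike.coe_set_eq, Submodule.top_coe, ← hK.closure_eq]
  exact (C.nondeg.mono hspan).closure_eq

theorem ext_proj [NormedAddCommGroup H₂] [InnerProductSpace ℂ H₂] (C : CoarseModule 𝒳 H₁)
    {t s : H₁ →L[ℂ] H₂}
    (h : ∀ A ∈ 𝒳.partition, ∀ w, t (C.proj A w) = s (C.proj A w)) : t = s := by
  have hK := C.eq_top_of_proj_mem (LinearMap.eqLocus (t : H₁ →ₗ[ℂ] H₂) s)
    (isClosed_eq t.continuous s.continuous) h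
  ext w
  exact (hK ▸ Submodule.mem_top : w ∈ LinearMap.eqLocus (t : H₁ →ₗ[ℂ] H₂) s)

theorem ext_proj_apply (C : CoarseModule 𝒳 H₁) {v w : H₁}
    (h : ∀ A ∈ 𝒳.partition, C.proj A v = C.proj A w) : v = w := by
  refine (innerSL_inj (𝕜 := ℂ)).1 (C.ext_proj fun A hA z => ?_)
  have hm := LFCMSpace.partition_meas hA
  simp only [innerSL_apply_apply]
  rw [← C.inner_proj hm, ← C.inner_proj hm, h A hA]

/-- An operator acting as the scalar `c x` on the range of the projection onto the block
of `x`. -/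
def ActsByScalars (C : CoarseModule 𝒳 H₁) (c : X → ℂ) (u : H₁ →L[ℂ] H₁) : Prop :=
  ∀ A ∈ 𝒳.partition, ∀ x ∈ A, ∀ w, u (C.proj A w) = c x • C.proj A w

namespace ActsByScalars

variable {C : CoarseModule 𝒳 H₁} {c d : X → ℂ} {u v : H₁ →L[ℂ] H₁}

theorem unique (hu : C.ActsByScalars c u) (hv : C.ActsByScalars c v) : u = v := by
  refine C.ext_proj fun A hA w => ?_
  obtain ⟨x, hx⟩ := 𝒳.isPartition.nonempty A hA
  rw [hu A hA x hx, hv A hA x hx]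

theorem comp (hu : C.ActsByScalars c u) (hv : C.ActsByScalars d v) :
    C.ActsByScalars (fun x => c x * d x) (u ∘L v) := by
  intro A hA x hx w
  rw [ContinuousLinearMap.comp_apply, hv A hA x hx, map_smul, hu A hA x hx, smul_smul, mul_comm]

theorem proj_apply (hc : 𝒳.coarse.ConstOnComponents c) (hu : C.ActsByScalars c u) {A : Set X}
    (hA : A ∈ 𝒳.partition) {x : X} (hx : x ∈ A) (w : H₁) :
    C.proj A (u w) = c x • C.proj A w := by
  suffices h : C.proj A ∘L u = c x • C.proj A from DFunLike.congr_fun h w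
  refine C.ext_proj fun B hB w => ?_
  obtain ⟨y, hy⟩ := 𝒳.isPartition.nonempty B hB
  simp only [ContinuousLinearMap.comp_apply, smul_apply, hu B hB y hy, map_smul]
  by_cases hAB : A = B
  · subst hAB
    rw [hc y x (LFCMSpace.sameComponent_of_mem_partition hA hy hx)]
  · simp [C.proj_proj_of_ne hA hB hAB]

theorem adjoint (hc : 𝒳.coarse.ConstOnComponents c) (hu : C.ActsByScalars c u) :
    C.ActsByScalars (fun x => star (c x)) (ContinuousLinearMap.adjoint u) := by
  intro A hA x hx w
  have hm := LFCMSpace.partition_meas hA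
  refine ext_inner_right ℂ fun z => ?_
  rw [ContinuousLinearMap.adjoint_inner_left, C.inner_proj hm, hu.proj_apply hc hA hx,
    inner_smul_left, inner_smul_right, C.inner_proj hm]
  simp

theorem isUnitaryOp (hc : 𝒳.coarse.ConstOnComponents c) (hc1 : ∀ x, ‖c x‖ = 1)
    (hu : C.ActsByScalars c u) : IsUnitaryOp u := by
  have hone : C.ActsByScalars (fun _ => 1) (ContinuousLinearMap.id ℂ H₁) := by
    intro A _ x _ w
    simp
  have hcc (x : X) : c x * star (c x) = 1 := by
    rw [Complex.star_def, Complex.mul_conj', hc1]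
    norm_num
  constructor
  · refine unique (c := fun x => star (c x) * c x) ((hu.adjoint hc).comp hu) ?_
    simpa only [mul_comm, hcc] using hone
  · refine unique (c := fun x => c x * star (c x)) (hu.comp (hu.adjoint hc)) ?_
    simpa only [hcc] using hone

theorem approximable (hu : C.ActsByScalars c u) : Approximable 𝒳 C.proj C.proj u := by
  intro ε hε
  refine ⟨u, ?_, by simp [hε.le]⟩
  refine 𝒳.coarse.mem_of_subset (𝒳.coarse.comp_mem 𝒳.disc_mem 𝒳.disc_mem) ?_
  rintro ⟨y, x⟩ ⟨_, ⟨B, A, rfl, hB, hBd, hA, hAd, hne⟩, hyB, hxA⟩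
  obtain ⟨A', hA', hAA'⟩ := LFCMSpace.exists_partition_superset hAd hxA
  have hfac : C.proj A = C.proj A' ∘L C.proj A := by
    rw [← C.proj_inter (LFCMSpace.partition_meas hA') hA, Set.inter_eq_self_of_subset_right hAA']
  have hcomp : C.proj B ∘L u ∘L C.proj A = c x • C.proj (B ∩ A) := by
    rw [C.proj_inter hB hA]
    ext w
    have hw : C.proj A w = C.proj A' (C.proj A w) := DFunLike.congr_fun hfac w
    simp only [ContinuousLinearMap.comp_apply, smul_apply]
    rw [hw, hu A' hA' x (hAA' hxA), map_smul]
  obtain ⟨z, hzB, hzA⟩ : (B ∩ A).Nonempty := by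
    by_contra h
    rw [Set.not_nonempty_iff_eq_empty] at h
    exact hne (by rw [hcomp, h, C.proj_empty, smul_zero])
  exact ⟨z, hBd ⟨hyB, hzB⟩, hAd ⟨hzA, hxA⟩⟩

end ActsByScalars

end CoarseModule

/-- The matrix coefficients of an approximable operator vanish between distinct coarse
components. -/
theorem Approximable.sameComponent
    [NormedAddCommGroup H₁] [InnerProductSpace ℂ H₁] [CompleteSpace H₁]
    [NormedAddCommGroup H₂] [InnerProductSpace ℂ H₂] [CompleteSpace H₂]
    {𝒳 : LFCMSpace X} {C : CoarseModule 𝒳 H₁} {D : CoarseModule 𝒳 H₂} {t : H₁ →L[ℂ] H₂}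
    (ht : Approximable 𝒳 C.proj D.proj t) {A B : Set X} (hA : A ∈ 𝒳.partition)
    (hB : B ∈ 𝒳.partition) {x y : X} (hx : x ∈ A) (hy : y ∈ B)
    (hne : D.proj B ∘L t ∘L C.proj A ≠ 0) : 𝒳.coarse.SameComponent y x := by
  by_contra hyx
  have hbound : ∀ ε : ℝ, 0 < ε →
      ‖D.proj B ∘L t ∘L C.proj A‖ ≤ ‖D.proj B‖ * (ε * ‖C.proj A‖) := by
    intro ε hε
    obtain ⟨s, hs, hts⟩ := ht ε hε
    have hs0 : D.proj B ∘L s ∘L C.proj A = 0 := by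
      by_contra hs0
      exact hyx (.of_mem hs ⟨B ×ˢ A, ⟨B, A, rfl, LFCMSpace.partition_meas hB,
        LFCMSpace.prod_subset_disc hB, LFCMSpace.partition_meas hA,
        LFCMSpace.prod_subset_disc hA, hs0⟩, hy, hx⟩)
    have hsub : D.proj B ∘L t ∘L C.proj A = D.proj B ∘L (t - s) ∘L C.proj A := by
      rw [ContinuousLinearMap.sub_comp, ContinuousLinearMap.comp_sub, hs0, sub_zero]
    rw [hsub]
    refine (ContinuousLinearMap.opNorm_comp_le _ _).trans ?_
    gcongr
    exact (ContinuousLinearMap.opNorm_comp_le _ _).trans (by gcongr)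
  have hpos : 0 < ‖D.proj B ∘L t ∘L C.proj A‖ := norm_pos_iff.2 hne
  set K := ‖D.proj B‖ * ‖C.proj A‖ with hK
  have hK0 : 0 ≤ K := by positivity
  have h := hbound (‖D.proj B ∘L t ∘L C.proj A‖ / (2 * (K + 1))) (by positivity)
  have h' : ‖D.proj B ∘L t ∘L C.proj A‖ * (2 * (K + 1)) ≤
      ‖D.proj B ∘L t ∘L C.proj A‖ * K := by
    calc _ ≤ (‖D.proj B‖ * (‖D.proj B ∘L t ∘L C.proj A‖ / (2 * (K + 1)) * ‖C.proj A‖))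
          * (2 * (K + 1)) := by gcongr
      _ = _ := by rw [hK]; field_simp
  nlinarith

namespace CoarseModule

variable {𝒳 : LFCMSpace X}
variable [NormedAddCommGroup H₁] [InnerProductSpace ℂ H₁] [CompleteSpace H₁]
variable [NormedAddCommGroup H₂] [InnerProductSpace ℂ H₂] [CompleteSpace H₂]

/-- Approximable operators intertwine operators acting by the same componentwise scalars. -/
theorem ActsByScalars.intertwine {C : CoarseModule 𝒳 H₁} {D : CoarseModule 𝒳 H₂} {c : X → ℂ}
    {u : H₁ →L[ℂ] H₁} {v : H₂ →L[ℂ] H₂} {t : H₁ →L[ℂ] H₂}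
    (hc : 𝒳.coarse.ConstOnComponents c) (hu : C.ActsByScalars c u) (hv : D.ActsByScalars c v)
    (ht : Approximable 𝒳 C.proj D.proj t) : t ∘L u = v ∘L t := by
  refine C.ext_proj fun A hA w => D.ext_proj_apply fun B hB => ?_
  obtain ⟨x, hx⟩ := 𝒳.isPartition.nonempty A hA
  obtain ⟨y, hy⟩ := 𝒳.isPartition.nonempty B hB
  simp only [ContinuousLinearMap.comp_apply]
  rw [hv.proj_apply hc hB hy, hu A hA x hx, map_smul, map_smul]
  by_cases h0 : D.proj B ∘L t ∘L C.proj A = 0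
  · have hw : D.proj B (t (C.proj A w)) = 0 := DFunLike.congr_fun h0 w
    rw [hw, smul_zero, smul_zero]
  · rw [hc y x (ht.sameComponent hA hB hx hy h0)]

theorem ActsByScalars.isCentralUnitary {C : CoarseModule 𝒳 H₁} {c : X → ℂ} {u : H₁ →L[ℂ] H₁}
    (hc : 𝒳.coarse.ConstOnComponents c) (hc1 : ∀ x, ‖c x‖ = 1) (hu : C.ActsByScalars c u) :
    IsCentralUnitary 𝒳 C u :=
  ⟨hu.approximable, hu.isUnitaryOp hc hc1, fun _ ht => (hu.intertwine hc hu ht).symm⟩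

/-- Rank one operators between blocks in the same coarse component are approximable. -/
theorem approximable_rankOne (C : CoarseModule 𝒳 H₁) {A B : Set X} (hA : A ∈ 𝒳.partition)
    (hB : B ∈ 𝒳.partition) {x y : X} (hx : x ∈ A) (hy : y ∈ B)
    (hyx : 𝒳.coarse.SameComponent y x) (v w : H₁) :
    Approximable 𝒳 C.proj C.proj (InnerProductSpace.rankOne ℂ (C.proj B w) (C.proj A v)) := by
  intro ε hε
  refine ⟨InnerProductSpace.rankOne ℂ (C.proj B w) (C.proj A v), ?_, by simp [hε.le]⟩
  have hd := 𝒳.coarse.comp_mem 𝒳.disc_mem 𝒳.disc_mem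
  refine 𝒳.coarse.mem_of_subset (𝒳.coarse.comp_mem hd (𝒳.coarse.comp_mem hyx hd)) ?_
  rintro ⟨q, p⟩ ⟨_, ⟨B', A', rfl, hB', hBd, hA', hAd, hne⟩, hqB, hpA⟩
  have hmA := LFCMSpace.partition_meas hA
  have hmB := LFCMSpace.partition_meas hB
  obtain ⟨b, hbB', hbB⟩ : (B' ∩ B).Nonempty := by
    by_contra h
    rw [Set.not_nonempty_iff_eq_empty] at h
    have h0 := C.proj_inter hB' hmB
    rw [h, C.proj_empty] at h0
    have h1 : C.proj B' (C.proj B w) = 0 := (DFunLike.congr_fun h0 w).symm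
    refine hne ?_
    ext z
    simp [h1]
  obtain ⟨a, haA, haA'⟩ : (A ∩ A').Nonempty := by
    by_contra h
    rw [Set.not_nonempty_iff_eq_empty] at h
    have h0 := C.proj_inter hmA hA'
    rw [h, C.proj_empty] at h0
    refine hne ?_
    ext z
    have h1 : C.proj A (C.proj A' z) = 0 := (DFunLike.congr_fun h0 z).symm
    simp [C.inner_proj hmA, h1]
  exact ⟨y, ⟨b, hBd ⟨hqB, hbB'⟩, LFCMSpace.prod_subset_disc hB ⟨hbB, hy⟩⟩, x, rfl,
    a, LFCMSpace.prod_subset_disc hA ⟨hx, haA⟩, hAd ⟨haA', hpA⟩⟩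

end CoarseModule

theorem IsUnitaryOp.norm_apply [NormedAddCommGroup H₁] [InnerProductSpace ℂ H₁] [CompleteSpace H₁]
    {u : H₁ →L[ℂ] H₁} (hu : IsUnitaryOp u) (w : H₁) : ‖u w‖ = ‖w‖ :=
  ContinuousLinearMap.norm_map_of_mem_unitary (Unitary.mem_iff.2 hu) w

namespace CoarseModule

variable {𝒳 : LFCMSpace X}
variable [NormedAddCommGroup H₁] [InnerProductSpace ℂ H₁] [CompleteSpace H₁]

/-- Central unitaries act by a scalar of modulus one on each coarse component. -/
theorem exists_actsByScalars_of_isCentralUnitary (C : CoarseModule 𝒳 H₁) {u : H₁ →L[ℂ] H₁}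
    (hu : IsCentralUnitary 𝒳 C u) : ∃ c : X → ℂ, 𝒳.coarse.ConstOnComponents c ∧
      (∀ x, ‖c x‖ = 1) ∧ C.ActsByScalars c u := by
  have key : ∀ q : Quotient 𝒳.coarse.componentSetoid, ∃ c : ℂ, ‖c‖ = 1 ∧
      ∀ A ∈ 𝒳.partition, ∀ x ∈ A, Quotient.mk _ x = q → ∀ w, u (C.proj A w) = c • C.proj A w := by
    intro q
    by_cases h : ∀ A ∈ 𝒳.partition, ∀ x ∈ A, Quotient.mk _ x = q → ∀ w, C.proj A w = 0
    · refine ⟨1, norm_one, fun A hA x hx hq w => ?_⟩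
      rw [h A hA x hx hq w, map_zero, smul_zero]
    push Not at h
    obtain ⟨A, hA, x, hx, rfl, v, hv⟩ := h
    set e := C.proj A v with he
    have hee : inner ℂ e e ≠ 0 := inner_self_ne_zero.2 hv
    have hscal : ∀ B ∈ 𝒳.partition, ∀ y ∈ B,
        Quotient.mk 𝒳.coarse.componentSetoid y = Quotient.mk _ x →
        ∀ w, u (C.proj B w) = (inner ℂ e (u e) / inner ℂ e e) • C.proj B w := by
      intro B hB y hy hyx w
      have h := DFunLike.congr_fun
        (hu.2.2 _ (C.approximable_rankOne hA hB hx hy (Quotient.exact hyx) v w)) e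
      simp only [ContinuousLinearMap.comp_apply, InnerProductSpace.rankOne_apply, map_smul,
        ← he] at h
      rw [div_eq_inv_mul, mul_smul, ← h, smul_smul, inv_mul_cancel₀ hee, one_smul]
    refine ⟨_, ?_, hscal⟩
    have hnorm := congrArg norm (hscal A hA x hx rfl v)
    rw [hu.2.1.norm_apply, norm_smul] at hnorm
    exact (mul_eq_right₀ (norm_ne_zero_iff.2 hv)).1 hnorm.symm
  choose c hc1 hc using key
  exact ⟨fun x => c (Quotient.mk _ x), fun x y hxy => congrArg c (Quotient.sound hxy),
    fun x => hc1 _, fun A hA x hx => hc _ A hA x hx rfl⟩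

/-- Every function of modulus one which is constant on components is realised by an operator. -/
theorem exists_actsByScalars (C : CoarseModule 𝒳 H₁) {c : X → ℂ}
    (hc : 𝒳.coarse.ConstOnComponents c) (hc1 : ∀ x, ‖c x‖ = 1) :
    ∃ u : H₁ →L[ℂ] H₁, C.ActsByScalars c u := by
  classical
  let pt (A : 𝒳.partition) : X := (𝒳.isPartition.nonempty A A.2).some
  have hpt (A : 𝒳.partition) : pt A ∈ (A : Set X) := (𝒳.isPartition.nonempty A A.2).some_mem
  let F (A : 𝒳.partition) : Submodule ℂ H₁ := (ContinuousLinearMap.id ℂ H₁ - C.proj A).ker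
  have hF (A : 𝒳.partition) (w : F A) : C.proj A w = w := by
    have h := w.2
    simp only [F, LinearMap.mem_ker] at h
    exact (sub_eq_zero.1 h).symm
  have hmem (A : 𝒳.partition) (w : H₁) : C.proj A w ∈ F A := by
    simp only [F, LinearMap.mem_ker]
    exact sub_eq_zero.2 (C.proj_proj (LFCMSpace.partition_meas A.2) w).symm
  have hcomplete (A : 𝒳.partition) : CompleteSpace (F A) :=
    (ContinuousLinearMap.isClosed_ker _).completeSpace_coe
  let V (A : 𝒳.partition) : F A →ₗᵢ[ℂ] H₁ := (F A).subtypeₗᵢ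
  let W (A : 𝒳.partition) : F A →ₗᵢ[ℂ] H₁ :=
    ⟨c (pt A) • (F A).subtype, fun w => by simp [norm_smul, hc1]⟩
  have hV : OrthogonalFamily ℂ (fun A => F A) V := by
    intro A B hAB v w
    have hAB' : (A : Set X) ≠ B := fun h => hAB (Subtype.ext h)
    change inner ℂ (v : H₁) (w : H₁) = 0
    rw [← hF A v, ← hF B w, C.inner_proj (LFCMSpace.partition_meas A.2),
      C.proj_proj_of_ne A.2 B.2 hAB', inner_zero_right]
  have hW : OrthogonalFamily ℂ (fun A => F A) W := by
    intro A B hAB v w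
    change inner ℂ (c (pt A) • (v : H₁)) (c (pt B) • (w : H₁)) = 0
    have h : inner ℂ (v : H₁) (w : H₁) = 0 := hV hAB v w
    rw [inner_smul_left, inner_smul_right, h, mul_zero, mul_zero]
  have total (U : ∀ A : 𝒳.partition, F A →ₗᵢ[ℂ] H₁)
      (hU : ∀ A w, C.proj A w ∈ LinearMap.range (U A).toLinearMap) :
      ⊤ ≤ (⨆ A, LinearMap.range (U A).toLinearMap).topologicalClosure := by
    refine (C.eq_top_of_proj_mem _ (Submodule.isClosed_topologicalClosure _) ?_).ge
    intro A hA w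
    exact Submodule.le_topologicalClosure _ (Submodule.mem_iSup_of_mem ⟨A, hA⟩ (hU ⟨A, hA⟩ w))
  have hVs : IsHilbertSum ℂ (fun A => F A) V :=
    .mk hV (total V fun A w => ⟨⟨_, hmem A w⟩, rfl⟩)
  have hWs : IsHilbertSum ℂ (fun A => F A) W := by
    refine .mk hW (total W fun A w => ⟨(c (pt A))⁻¹ • ⟨_, hmem A w⟩, ?_⟩)
    have hne : c (pt A) ≠ 0 := norm_ne_zero_iff.1 (by simp [hc1])
    change c (pt A) • ((c (pt A))⁻¹ • C.proj A w) = C.proj A w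
    rw [smul_smul, mul_inv_cancel₀ hne, one_smul]
  refine ⟨(hVs.linearIsometryEquiv.trans hWs.linearIsometryEquiv.symm :
    H₁ ≃ₗᵢ[ℂ] H₁).toContinuousLinearEquiv, fun A hA x hx w => ?_⟩
  have h1 := hVs.linearIsometryEquiv_symm_apply_single (i := ⟨A, hA⟩) ⟨_, hmem ⟨A, hA⟩ w⟩
  have h2 := hWs.linearIsometryEquiv_symm_apply_single (i := ⟨A, hA⟩) ⟨_, hmem ⟨A, hA⟩ w⟩
  rw [LinearIsometryEquiv.symm_apply_eq] at h1
  change hWs.linearIsometryEquiv.symm (hVs.linearIsometryEquiv (C.proj A w)) = _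
  change _ = hVs.linearIsometryEquiv (C.proj A w) at h1
  rw [← h1, h2, hc x _ (LFCMSpace.sameComponent_of_mem_partition hA hx (hpt ⟨A, hA⟩))]
  rfl

theorem isCentralUnitary_comp (C : CoarseModule 𝒳 H₁) {u v : H₁ →L[ℂ] H₁}
    (hu : IsCentralUnitary 𝒳 C u) (hv : IsCentralUnitary 𝒳 C v) :
    IsCentralUnitary 𝒳 C (u ∘L v) := by
  obtain ⟨c, hc, hc1, hcu⟩ := C.exists_actsByScalars_of_isCentralUnitary hu
  obtain ⟨d, hd, hd1, hdv⟩ := C.exists_actsByScalars_of_isCentralUnitary hv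
  exact (hcu.comp hdv).isCentralUnitary (fun x y h => by rw [hc x y h, hd x y h])
    fun x => by rw [norm_mul, hc1, hd1, one_mul]

end CoarseModule

/-- Central unitaries can be moved from the source to the target of an approximable operator. -/
theorem IsCentralUnitary.exists_intertwine
    [NormedAddCommGroup H₁] [InnerProductSpace ℂ H₁] [CompleteSpace H₁]
    [NormedAddCommGroup H₂] [InnerProductSpace ℂ H₂] [CompleteSpace H₂]
    {𝒳 : LFCMSpace X} {C : CoarseModule 𝒳 H₁} {u : H₁ →L[ℂ] H₁} (hu : IsCentralUnitary 𝒳 C u)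
    (D : CoarseModule 𝒳 H₂) {t : H₁ →L[ℂ] H₂} (ht : Approximable 𝒳 C.proj D.proj t) :
    ∃ v : H₂ →L[ℂ] H₂, IsCentralUnitary 𝒳 D v ∧ t ∘L u = v ∘L t := by
  obtain ⟨c, hc, hc1, hcu⟩ := C.exists_actsByScalars_of_isCentralUnitary hu
  obtain ⟨v, hv⟩ := D.exists_actsByScalars hc hc1
  exact ⟨v, hv.isCentralUnitary hc hc1, hcu.intertwine hc hv ht⟩

/-- Central unitaries can be moved across approximable operators, and the
relation of equivalence modulo central unitaries is a congruence on `𝒜(𝒳)`. -/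
theorem congruentModCentral_congruence {X : Type} {H₁ H₂ H₃ : Type}
    [NormedAddCommGroup H₁] [InnerProductSpace ℂ H₁] [CompleteSpace H₁]
    [NormedAddCommGroup H₂] [InnerProductSpace ℂ H₂] [CompleteSpace H₂]
    [NormedAddCommGroup H₃] [InnerProductSpace ℂ H₃] [CompleteSpace H₃]
    (𝒳 : LFCMSpace X)
    (C : CoarseModule 𝒳 H₁) (D : CoarseModule 𝒳 H₂) (G : CoarseModule 𝒳 H₃)
    (t : H₁ →L[ℂ] H₂) (ht : Approximable 𝒳 C.proj D.proj t)
    (u : H₁ →L[ℂ] H₁) (hu : IsCentralUnitary 𝒳 C u) :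
    (∃ v : H₂ →L[ℂ] H₂, IsCentralUnitary 𝒳 D v ∧ t ∘L u = v ∘L t) ∧
      ∀ (t₁ t₂ : H₁ →L[ℂ] H₂) (s₁ s₂ : H₂ →L[ℂ] H₃),
        Approximable 𝒳 C.proj D.proj t₁ → Approximable 𝒳 C.proj D.proj t₂ →
        Approximable 𝒳 D.proj G.proj s₁ → Approximable 𝒳 D.proj G.proj s₂ →
        CongruentModCentral 𝒳 C D t₁ t₂ → CongruentModCentral 𝒳 D G s₁ s₂ →
        CongruentModCentral 𝒳 C G (s₁ ∘L t₁) (s₂ ∘L t₂) := by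
  refine ⟨hu.exists_intertwine D ht, ?_⟩
  rintro _ t₂ _ s₂ - - - hs₂ ⟨u₁, v₁, hu₁, hv₁, rfl⟩ ⟨u₂, v₂, hu₂, hv₂, rfl⟩
  obtain ⟨w, hw, hsw⟩ := (D.isCentralUnitary_comp hu₂ hv₁).exists_intertwine G hs₂
  refine ⟨u₁, v₂ ∘L w, hu₁, G.isCentralUnitary_comp hv₂ hw, ?_⟩
  ext z
  simpa using congrArg v₂ (DFunLike.congr_fun hsw (t₂ (u₁ z)))
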